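/- arXiv:1110.2078 — 12 statements merged into one kernel-verified Lean document; each statement's English description precedes it below -/
import Mathlib

section
/- Let (N, [·,...,·]) be an n-ary Nambu algebra over a field K of characteristic zero and let ρ: N → N be an n-ary Nambu algebra endomorphism, i.e. a linear map with ρ([x_1,...,x_n]) = [ρ(x_1),...,ρ(x_n)] for all x_i ∈ N. Then (N, ρ∘[·,...,·], ρ) is an n-ary multiplicative Hom-Nambu algebra: the bracket {x_1,...,x_n} := ρ([x_1,...,x_n]) together with the twist maps α_1 = ... = α_{n-1} = ρ satisfies the Hom-Nambu identity and ρ({x_1,...,x_n}) = {ρ(x_1),...,ρ(x_n)}. -/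
/-- The Hom-Nambu identity for an `(m+1)`-ary bracket `br` with twist maps
`α : Fin m → (N →ₗ[K] N)`:
`[α₀ x₀, …, α_{m-1} x_{m-1}, [y₀,…,y_m]] = ∑ i, [α₀ y₀, …, [x₀,…,x_{m-1}, y_i], …, α_{m-1} y_m]`. -/
def HomNambu {K : Type*} [Field K] {N : Type*} [AddCommGroup N] [Module K N] {m : ℕ}
    (br : (Fin (m + 1) → N) → N) (α : Fin m → (N →ₗ[K] N)) : Prop :=
  ∀ (x : Fin m → N) (y : Fin (m + 1) → N),
    br (Fin.snoc (fun i => α i (x i)) (br y)) =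
      ∑ i : Fin (m + 1), br (fun j =>
        if h : (j : ℕ) < (i : ℕ) then α ⟨(j : ℕ), by have := i.2; omega⟩ (y j)
        else if h' : (j : ℕ) = (i : ℕ) then br (Fin.snoc x (y i))
        else α ⟨(j : ℕ) - 1, by have := j.2; omega⟩ (y j))

/-- If `(N, br)` is an `n`-ary Nambu algebra (char-zero field `K`) and
`ρ : N → N` is a Nambu-algebra endomorphism, then `(N, ρ ∘ br, ρ)` is a multiplicative
`n`-ary Hom-Nambu algebra. -/
theorem twist_of_nambu_endomorphism
    {K : Type*} [Field K] [CharZero K] {N : Type*} [AddCommGroup N] [Module K N]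
    {m : ℕ} (hm : 1 ≤ m)
    (br : MultilinearMap K (fun _ : Fin (m + 1) => N) N)
    (hNambu : HomNambu (K := K) (⇑br) (fun _ => LinearMap.id))
    (ρ : N →ₗ[K] N)
    (hρ : ∀ x : Fin (m + 1) → N, ρ (br x) = br (fun i => ρ (x i))) :
    HomNambu (K := K) (fun x => ρ (br x)) (fun _ => ρ) ∧
      ∀ x : Fin (m + 1) → N, ρ (ρ (br x)) = ρ (br (fun i => ρ (x i))) := by
  refine ⟨fun x y => ?_, fun x => congrArg ρ (hρ x)⟩
  have hsnoc : (Fin.snoc (fun i => ρ (x i)) (ρ (br y)) : Fin (m + 1) → N) =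
      fun i => ρ ((Fin.snoc x (br y) : Fin (m + 1) → N) i) := by
    ext i
    refine Fin.lastCases ?_ (fun j => ?_) i <;> simp
  have key := hNambu x y
  simp only [LinearMap.id_apply] at key
  simp only [hsnoc]
  rw [← hρ, key, map_sum, map_sum]
  refine Finset.sum_congr rfl fun i _ => ?_
  rw [hρ]
  congr 2
  ext j
  split_ifs <;> rfl
end

section
/- Let (N, [·,...,·], α) be a multiplicative n-ary Hom-Nambu algebra. Then (N, α^{n-1}∘[·,...,·], α^n) is an n-ary multiplicative Hom-Nambu algebra: the bracket {x_1,...,x_n} := α^{n-1}([x_1,...,x_n]) together with the twist map α^n satisfies the Hom-Nambu identity and is multiplicative with respect to α^n. -/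
/-- If `α` commutes with the bracket `br`, then so does every power of `α`. -/
theorem pow_apply_bracket {K : Type*} [Field K] {N : Type*} [AddCommGroup N] [Module K N]
    {ι : Type*} {br : (ι → N) → N} {α : N →ₗ[K] N}
    (hmult : ∀ x : ι → N, α (br x) = br (fun i => α (x i))) (k : ℕ) (x : ι → N) :
    (α ^ k) (br x) = br (fun i => (α ^ k) (x i)) := by
  induction k with
  | zero => simp
  | succ k ih => simp only [pow_succ', Module.End.mul_apply, ih, hmult]

/-- If `(N, br, α)` is a multiplicative `n`-ary Hom-Nambu algebra
(`n = m+1`), then `(N, α^{n-1} ∘ br, α^n)` is a multiplicative `n`-ary Hom-Nambu algebra. -/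
theorem second_twist_of_multiplicative_homNambu
    {K : Type*} [Field K] [CharZero K] {N : Type*} [AddCommGroup N] [Module K N]
    {m : ℕ} (hm : 1 ≤ m)
    (br : MultilinearMap K (fun _ : Fin (m + 1) => N) N)
    (α : N →ₗ[K] N)
    (hNambu : HomNambu (K := K) (⇑br) (fun _ => α))
    (hmult : ∀ x : Fin (m + 1) → N, α (br x) = br (fun i => α (x i))) :
    HomNambu (K := K) (fun x => (α ^ m) (br x)) (fun _ => α ^ (m + 1)) ∧
      ∀ x : Fin (m + 1) → N,
        (α ^ (m + 1)) ((α ^ m) (br x)) = (α ^ m) (br (fun i => (α ^ (m + 1)) (x i))) := by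
  have hpow := pow_apply_bracket (br := ⇑br) hmult
  have hsucc : ∀ z : N, (α ^ (m + 1)) z = (α ^ m) (α z) := fun z => by
    rw [pow_succ, Module.End.mul_apply]
  refine ⟨fun x y => ?_, fun x => ?_⟩
  · have key := congrArg (fun z => (α ^ m) ((α ^ m) z)) (hNambu x y)
    simp only [map_sum] at key
    convert key using 2
    · rw [hpow m (Fin.snoc _ _)]
      congr 2
      funext j
      refine Fin.lastCases ?_ (fun j => ?_) j <;> simp [hsucc]
    · rw [hpow m (fun _ => _)]
      congr 1
      funext j
      split_ifs <;> simp [hsucc]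
  · rw [← hpow, ← Module.End.mul_apply, ← Module.End.mul_apply, ← pow_add, ← pow_add, add_comm]
end

section
/- Let (A, μ, (η_1,...,η_{n-1})) be a symmetric n-ary totally Hom-associative algebra and (N, [·,...,·]_N, (α_1,...,α_{n-1})) an n-ary Hom-Nambu algebra over K. Then the tensor product A ⊗ N with the n-linear operation [a_1⊗x_1,...,a_n⊗x_n] = μ(a_1,...,a_n) ⊗ [x_1,...,x_n]_N and the linear maps ζ_i = η_i ⊗ α_i (i.e. ζ_i(a⊗x) = η_i(a)⊗α_i(x)) is an n-ary Hom-Nambu algebra, i.e. satisfies the Hom-Nambu identity with twist maps (ζ_1,...,ζ_{n-1}). -/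
open scoped TensorProduct

/-- The `k`-th expression in the total Hom-associativity chain for an `(m+1)`-ary product
`μ` with twist maps `η : Fin m → (A →ₗ[K] A)`, evaluated on `a : Fin (2m+1) → A`:
`μ(η₀(a₀), …, η_{k-1}(a_{k-1}), μ(a_k, …, a_{k+m}), η_k(a_{m+k+1}), …, η_{m-1}(a_{2m}))`. -/
def assocExpr {K : Type*} [Field K] {A : Type*} [AddCommGroup A] [Module K A] {m : ℕ}
    (μ : (Fin (m + 1) → A) → A) (η : Fin m → (A →ₗ[K] A))
    (a : Fin (2 * m + 1) → A) (k : Fin (m + 1)) : A :=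
  μ (fun j =>
    if h : (j : ℕ) < (k : ℕ) then
      η ⟨(j : ℕ), by have := k.2; omega⟩ (a ⟨(j : ℕ), by have := j.2; omega⟩)
    else if h' : (j : ℕ) = (k : ℕ) then
      μ (fun l => a ⟨(k : ℕ) + (l : ℕ), by have := k.2; have := l.2; omega⟩)
    else
      η ⟨(j : ℕ) - 1, by have := j.2; omega⟩ (a ⟨(j : ℕ) + m, by have := j.2; omega⟩))

namespace MultilinearMap

/-- Multilinear maps on tensor products are determined by their values on pure tensors. -/
theorem ext_tmul {K A N M ι : Type*} [Field K] [AddCommGroup A] [Module K A]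
    [AddCommGroup N] [Module K N] [AddCommGroup M] [Module K M] [Finite ι]
    {f g : MultilinearMap K (fun _ : ι => A ⊗[K] N) M}
    (h : ∀ (a : ι → A) (x : ι → N),
      f (fun i => a i ⊗ₜ[K] x i) = g (fun i => a i ⊗ₜ[K] x i)) : f = g := by
  let b := (Module.Basis.ofVectorSpace K A).tensorProduct (Module.Basis.ofVectorSpace K N)
  refine Module.Basis.ext_multilinear (fun _ => b) fun v => ?_
  simpa only [b, Module.Basis.tensorProduct_apply'] using h _ _

end MultilinearMap

/-- In a symmetric totally Hom-associative algebra the iterated product of `2m+1` elements does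
not depend on their order. -/
theorem assocExpr_comp_perm {K A : Type*} [Field K] [AddCommGroup A] [Module K A] {m : ℕ}
    {μ : (Fin (m + 1) → A) → A} {η : Fin m → (A →ₗ[K] A)}
    (hsymm : ∀ (σ : Equiv.Perm (Fin (m + 1))) (a : Fin (m + 1) → A), μ (a ∘ σ) = μ a)
    (hassoc : ∀ (a : Fin (2 * m + 1) → A) (k k' : Fin (m + 1)),
      assocExpr μ η a k = assocExpr μ η a k')
    (σ : Equiv.Perm (Fin (2 * m + 1))) (a : Fin (2 * m + 1) → A) (k : Fin (m + 1)) :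
    assocExpr μ η (a ∘ σ) k = assocExpr μ η a k := by
  have hσ : σ ∈ Submonoid.closure
      (Set.range fun i : Fin (2 * m) => Equiv.swap i.castSucc i.succ) := by
    rw [Equiv.Perm.mclosure_swap_castSucc_succ]; trivial
  induction hσ using Submonoid.closure_induction generalizing a with
  | one => rfl
  | mul s t _ _ hs ht => rw [Equiv.Perm.coe_mul, ← Function.comp_assoc, ht, hs]
  | mem s hs =>
    obtain ⟨j, rfl⟩ := hs
    -- a product block containing both transposed positions
    obtain ⟨c, l, hcl⟩ : ∃ (c : Fin (m + 1)) (l : Fin m), (j : ℕ) = c + l := by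
      by_cases hj : (j : ℕ) < m
      · exact ⟨0, ⟨j, hj⟩, by simp⟩
      · exact ⟨Fin.last m, ⟨j - m, by omega⟩, by simp; omega⟩
    rw [hassoc _ k c, hassoc _ k c]
    unfold assocExpr
    congr 1
    funext i
    have hfix : ∀ p : Fin (2 * m + 1), (p : ℕ) < c ∨ (c : ℕ) + m < p →
        (a ∘ Equiv.swap j.castSucc j.succ) p = a p := by
      intro p hp
      rw [Function.comp_apply, Equiv.swap_apply_of_ne_of_ne] <;>
        (rw [Ne, Fin.ext_iff]; simp; omega)
    split_ifs with h h'
    · rw [hfix]; exact Or.inl h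
    · rw [← hsymm (Equiv.swap l.castSucc l.succ)]
      congr 1
      funext q
      simp only [Function.comp_apply, Equiv.swap_apply_def, Fin.ext_iff, Fin.val_castSucc,
        Fin.val_succ]
      congr 1
      ext
      split_ifs <;> simp at * <;> omega
    · rw [hfix]; right; simp only; omega

/-- The exchange law `μ(η(a), μ(b)) = μ(η(b₀), …, μ(a, bᵢ), …, η(bₘ))`. -/
theorem homAssoc_exchange {K A : Type*} [Field K] [AddCommGroup A] [Module K A] {m : ℕ}
    {μ : (Fin (m + 1) → A) → A} {η : Fin m → (A →ₗ[K] A)}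
    (hsymm : ∀ (σ : Equiv.Perm (Fin (m + 1))) (a : Fin (m + 1) → A), μ (a ∘ σ) = μ a)
    (hassoc : ∀ (a : Fin (2 * m + 1) → A) (k k' : Fin (m + 1)),
      assocExpr μ η a k = assocExpr μ η a k')
    (a : Fin m → A) (b : Fin (m + 1) → A) (i : Fin (m + 1)) :
    μ (Fin.snoc (fun j => η j (a j)) (μ b)) = μ (fun j =>
        if h : (j : ℕ) < (i : ℕ) then η ⟨(j : ℕ), by have := i.2; omega⟩ (b j)
        else if h' : (j : ℕ) = (i : ℕ) then μ (Fin.snoc a (b i))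
        else η ⟨(j : ℕ) - 1, by have := j.2; omega⟩ (b j)) := by
  let c : Fin (2 * m + 1) → A := fun p =>
    if h : (p : ℕ) < m then a ⟨p, h⟩ else b ⟨p - m, by omega⟩
  let s : Fin (2 * m + 1) → Fin (2 * m + 1) := fun p =>
    if (p : ℕ) < i then ⟨(p + m : ℕ) % (2 * m + 1), Nat.mod_lt _ (by omega)⟩
    else if (p : ℕ) < i + m then ⟨p - i, by omega⟩ else p
  have hs : ∀ p, (s p : ℕ) =
      if (p : ℕ) < i then p + m else if (p : ℕ) < i + m then p - i else p := by
    intro p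
    simp only [s]
    split_ifs <;> simp
    omega
  have hinj : Function.Injective s := by
    intro p q hpq
    have := congrArg Fin.val hpq
    rw [hs, hs] at this
    ext
    split_ifs at this <;> omega
  have key := assocExpr_comp_perm hsymm hassoc
    (Equiv.ofBijective s (Finite.injective_iff_bijective.1 hinj)) c i
  rw [hassoc c i (Fin.last m)] at key
  have ha : ∀ (p : Fin (2 * m + 1)) (j : Fin m), (p : ℕ) = j → c p = a j := by
    intro p j h
    have : (p : ℕ) < m := by omega
    simp only [c, this, dif_pos]
    congr 1
    ext
    exact h
  have hb : ∀ (p : Fin (2 * m + 1)) (j : Fin (m + 1)), (p : ℕ) = j + m → c p = b j := by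
    intro p j h
    have : ¬ (p : ℕ) < m := by omega
    simp only [c, this, dif_neg, not_false_iff]
    congr 1
    ext
    simp only; omega
  convert key.symm using 1
  · unfold assocExpr
    congr 1
    funext j
    refine Fin.lastCases ?_ (fun j => ?_) j
    · simp only [Fin.snoc_last, Fin.val_last, lt_irrefl, dif_neg, dif_pos, not_false_iff]
      congr 1
      funext l
      exact (hb _ _ (by simp only; omega)).symm
    · simp only [Fin.snoc_castSucc, Fin.val_castSucc, Fin.val_last, j.2, dif_pos]
      rw [ha _ j rfl]
  · unfold assocExpr
    congr 1
    funext j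
    simp only [Function.comp_apply, Equiv.ofBijective_apply]
    split_ifs with h h'
    · rw [hb _ j]
      rw [hs, if_pos h]
    · congr 1
      funext l
      refine Fin.lastCases ?_ (fun l => ?_) l
      · rw [Fin.snoc_last, hb _ i]
        rw [hs]; simp
      · rw [Fin.snoc_castSucc, ha _ l]
        rw [hs]; simp
    · rw [hb _ j]
      rw [hs]; simp only; split_ifs <;> omega


/-- The tensor product of a symmetric `n`-ary totally Hom-associative algebra
`(A, μ, η)` with an `n`-ary Hom-Nambu algebra `(N, brN, α)` is an `n`-ary Hom-Nambu algebra
with bracket `[a₁⊗x₁,…,aₙ⊗xₙ] = μ(a₁,…,aₙ) ⊗ [x₁,…,xₙ]` and twists `ζᵢ = ηᵢ ⊗ αᵢ`. -/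
theorem tensorProduct_homNambu
    {K : Type*} [Field K] [CharZero K]
    {A : Type*} [AddCommGroup A] [Module K A]
    {N : Type*} [AddCommGroup N] [Module K N]
    {m : ℕ} (hm : 1 ≤ m)
    (μ : MultilinearMap K (fun _ : Fin (m + 1) => A) A)
    (η : Fin m → (A →ₗ[K] A))
    (hsymm : ∀ (σ : Equiv.Perm (Fin (m + 1))) (a : Fin (m + 1) → A), μ (a ∘ σ) = μ a)
    (hassoc : ∀ (a : Fin (2 * m + 1) → A) (k k' : Fin (m + 1)),
      assocExpr (K := K) (⇑μ) η a k = assocExpr (K := K) (⇑μ) η a k')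
    (brN : MultilinearMap K (fun _ : Fin (m + 1) => N) N)
    (α : Fin m → (N →ₗ[K] N))
    (hN : HomNambu (K := K) (⇑brN) α)
    (brT : MultilinearMap K (fun _ : Fin (m + 1) => A ⊗[K] N) (A ⊗[K] N))
    (hpure : ∀ (a : Fin (m + 1) → A) (x : Fin (m + 1) → N),
      brT (fun i => a i ⊗ₜ[K] x i) = μ a ⊗ₜ[K] brN x) :
    HomNambu (K := K) (⇑brT) (fun i => TensorProduct.map (η i) (α i)) := by
  intro x y
  let ζ : Fin m → (A ⊗[K] N →ₗ[K] A ⊗[K] N) := fun i => TensorProduct.map (η i) (α i)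
  let D := brT.curryRight
  let twist : Fin (m + 1) → (Fin m → A ⊗[K] N) → Fin (m + 1) → (A ⊗[K] N →ₗ[K] A ⊗[K] N) :=
    fun i x j =>
      if h : (j : ℕ) < (i : ℕ) then ζ ⟨(j : ℕ), by have := i.2; omega⟩
      else if h' : (j : ℕ) = (i : ℕ) then D x
      else ζ ⟨(j : ℕ) - 1, by have := j.2; omega⟩
  have htwist : ∀ (i : Fin (m + 1)) x (y : Fin (m + 1) → A ⊗[K] N), (fun j : Fin (m + 1) =>
        if h : (j : ℕ) < (i : ℕ) then ζ ⟨(j : ℕ), by have := i.2; omega⟩ (y j)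
        else if h' : (j : ℕ) = (i : ℕ) then brT (Fin.snoc x (y i))
        else ζ ⟨(j : ℕ) - 1, by have := j.2; omega⟩ (y j)) = fun j => twist i x j (y j) := by
    intro i x y
    funext j
    simp only [twist]
    split_ifs with h h'
    · rfl
    · obtain rfl := Fin.ext h'
      rfl
    · rfl
  change (D.compLinearMap ζ x) (brT y) = _
  refine Eq.trans ?_ (Finset.sum_congr rfl fun i _ => congrArg brT (htwist i x y).symm)
  suffices H : (D.compLinearMap ζ x).compMultilinearMap brT =
      ∑ i, brT.compLinearMap (twist i x) by
    simpa using congrArg (fun f => f y) H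
  refine MultilinearMap.ext_tmul fun b v => ?_
  set y : Fin (m + 1) → A ⊗[K] N := fun i => b i ⊗ₜ[K] v i with hy
  have hup : ∀ i (x' : Fin m → A ⊗[K] N),
      Function.update (fun j => twist i x j (y j)) i (D x' (y i)) =
        fun j => twist i x' j (y j) := by
    intro i x'
    funext j
    by_cases hj : j = i
    · subst hj
      simp [twist]
    · have : (j : ℕ) ≠ i := fun h => hj (Fin.ext h)
      simp [twist, hj, this]
  suffices H : (LinearMap.applyₗ (brT y)).compMultilinearMap (D.compLinearMap ζ) =
      ∑ i, ((brT.toLinearMap (fun j => twist i x j (y j)) i).comp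
        (LinearMap.applyₗ (y i))).compMultilinearMap D by
    simpa [hup] using congrArg (fun f => f x) H
  refine MultilinearMap.ext_tmul fun a u => ?_
  have hsnoc : ∀ (a : Fin m → A) (u : Fin m → N) (b : A) (v : N),
      brT (Fin.snoc (fun i => a i ⊗ₜ[K] u i) (b ⊗ₜ[K] v)) =
        μ (Fin.snoc a b) ⊗ₜ[K] brN (Fin.snoc u v) := by
    intro a u b v
    rw [← hpure]
    congr 1
    funext j
    refine Fin.lastCases ?_ (fun j => ?_) j <;> simp
  have hterm : ∀ i, brT (fun j => twist i (fun i => a i ⊗ₜ[K] u i) j (y j)) =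
      μ (Fin.snoc (fun j => η j (a j)) (μ b)) ⊗ₜ[K] brN (fun j =>
        if h : (j : ℕ) < (i : ℕ) then α ⟨(j : ℕ), by have := i.2; omega⟩ (v j)
        else if h' : (j : ℕ) = (i : ℕ) then brN (Fin.snoc u (v i))
        else α ⟨(j : ℕ) - 1, by have := j.2; omega⟩ (v j)) := by
    intro i
    rw [homAssoc_exchange hsymm hassoc a b i, ← hpure, ← htwist]
    congr 1
    funext j
    split_ifs with h h'
    · rfl
    · exact hsnoc _ _ _ _
    · rfl
  have hlhs : D (fun j => ζ j (a j ⊗ₜ[K] u j)) (brT y) =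
      μ (Fin.snoc (fun j => η j (a j)) (μ b)) ⊗ₜ[K]
        brN (Fin.snoc (fun j => α j (u j)) (brN v)) := by
    rw [hy, hpure]
    exact hsnoc _ _ _ _
  have hsum := congrArg (fun w => μ (Fin.snoc (fun j => η j (a j)) (μ b)) ⊗ₜ[K] w) (hN u v)
  rw [TensorProduct.tmul_sum] at hsum
  refine hlhs.trans (hsum.trans ?_)
  rw [sum_apply]
  exact Finset.sum_congr rfl fun i _ => by rw [← hterm, ← hup]; rfl
end

section
/- Let (N, [·,...,·], α̃ = (α_1,...,α_{n-1})) be an n-ary Hom-Nambu algebra and (V, ρ, ν) a representation of N on a vector space V. Define ρ*: N^{n-1} → End(V*) by ρ*(x) = −ᵗρ(x) (i.e. (ρ*(x)f)(v) = −f(ρ(x)v)) and ν*: V* → V*, f ↦ f∘ν. Then (V*, ρ*, ν*) is a representation of N if and only if for all x = (x_1,...,x_{n-1}), y ∈ N^{n-1}: ρ(x)∘ρ(α̃(y)) − ρ(y)∘ρ(α̃(x)) = Σ_{i=1}^{n-1} ν ∘ ρ(α_1(x_1),...,α_{i-1}(x_{i-1}), L(y)·x_i, α_i(x_{i+1}),...,α_{n-2}(x_{n-1})).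 -/
/-- The tuple `(α₁(x₁), …, α_{i-1}(x_{i-1}), L(y)·xᵢ, αᵢ(x_{i+1}), …, α_{n-2}(x_{n-1}))`
appearing in the representation identity, where `L(y)·xᵢ = [y₁,…,y_{n-1},xᵢ]`. -/
def repTuple {K : Type*} [Field K] {N : Type*} [AddCommGroup N] [Module K N] {m : ℕ}
    (br : (Fin (m + 1) → N) → N) (α : Fin m → (N →ₗ[K] N))
    (x y : Fin m → N) (i : Fin m) : Fin m → N :=
  fun j =>
    if h : (j : ℕ) < (i : ℕ) then α j (x j)
    else if h' : (j : ℕ) = (i : ℕ) then br (Fin.snoc y (x i))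
    else α ⟨(j : ℕ) - 1, by have := j.2; omega⟩ (x j)

/-- The defining identity of a representation `(V, ρ, ν)` of an `n`-ary Hom-Nambu algebra:
`ρ(α̃(x)) ∘ ρ(y) − ρ(α̃(y)) ∘ ρ(x) = ∑ᵢ ρ(α₁(x₁),…,L(y)·xᵢ,…,α_{n-2}(x_{n-1})) ∘ ν`. -/
def IsRepCond {K : Type*} [Field K] {N : Type*} [AddCommGroup N] [Module K N] {m : ℕ}
    {V : Type*} [AddCommGroup V] [Module K V]
    (br : (Fin (m + 1) → N) → N) (α : Fin m → (N →ₗ[K] N))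
    (ρ : (Fin m → N) → Module.End K V) (ν : Module.End K V) : Prop :=
  ∀ x y : Fin m → N,
    ρ (fun i => α i (x i)) * ρ y - ρ (fun i => α i (y i)) * ρ x =
      (∑ i : Fin m, ρ (repTuple br α x y i)) * ν

/-- Taking transposes of endomorphisms of a vector space is injective. -/
theorem LinearMap.dualMap_inj_of_field {K : Type*} [Field K] {V : Type*} [AddCommGroup V]
    [Module K V] {f g : Module.End K V} :
    LinearMap.dualMap f = LinearMap.dualMap g ↔ f = g := by
  refine ⟨fun h => LinearMap.ext fun v => ?_, fun h => h ▸ rfl⟩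
  refine (Module.forall_dual_apply_eq_zero_iff K _).1 (fun φ => ?_) |> sub_eq_zero.1
  rw [map_sub, sub_eq_zero]
  exact LinearMap.congr_fun (LinearMap.congr_fun h φ) v

/-- For a representation `(V, ρ, ν)` of an `n`-ary Hom-Nambu algebra
`(N, br, α)`, the dual data `(V*, ρ* = −ᵗρ, ν* = (·) ∘ ν)` is a representation iff
`ρ(x)∘ρ(α̃(y)) − ρ(y)∘ρ(α̃(x)) = ∑ᵢ ν ∘ ρ(α₁(x₁),…,L(y)·xᵢ,…,α_{n-2}(x_{n-1}))`. -/
theorem dual_representation_iff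
    {K : Type*} [Field K] [CharZero K] {N : Type*} [AddCommGroup N] [Module K N]
    {m : ℕ} (hm : 1 ≤ m)
    (br : MultilinearMap K (fun _ : Fin (m + 1) => N) N)
    (α : Fin m → (N →ₗ[K] N))
    (hNambu : HomNambu (K := K) (⇑br) α)
    {V : Type*} [AddCommGroup V] [Module K V]
    (ρ : MultilinearMap K (fun _ : Fin m => N) (Module.End K V))
    (hskew : ∀ (σ : Equiv.Perm (Fin m)) (x : Fin m → N),
      ρ (x ∘ σ) = (Equiv.Perm.sign σ : ℤ) • ρ x)
    (ν : Module.End K V)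
    (hrep : IsRepCond (K := K) (⇑br) α (fun x => ρ x) ν) :
    IsRepCond (K := K) (⇑br) α
        (fun x => -LinearMap.dualMap (ρ x)) (LinearMap.dualMap ν) ↔
      ∀ x y : Fin m → N,
        ρ x * ρ (fun i => α i (y i)) - ρ y * ρ (fun i => α i (x i)) =
          ∑ i : Fin m, ν * ρ (repTuple (K := K) (⇑br) α x y i) := by
  refine forall₂_congr fun x y => ?_
  have hl : -LinearMap.dualMap (ρ fun i => α i (x i)) * -LinearMap.dualMap (ρ y) -
        -LinearMap.dualMap (ρ fun i => α i (y i)) * -LinearMap.dualMap (ρ x) =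
      -LinearMap.dualMap (ρ x * ρ (fun i => α i (y i)) - ρ y * ρ (fun i => α i (x i))) := by
    ext φ v
    simp
  have hr : (∑ i : Fin m, -LinearMap.dualMap (ρ (repTuple (K := K) (⇑br) α x y i))) *
        LinearMap.dualMap ν =
      -LinearMap.dualMap (∑ i : Fin m, ν * ρ (repTuple (K := K) (⇑br) α x y i)) := by
    ext φ v
    simp [LinearMap.sum_apply]
  rw [hl, hr]
  exact (neg_inj (G := Module.End K (Module.Dual K V))).trans
    (LinearMap.dualMap_inj_of_field (K := K) (V := V))
end

section
/- Let (N, [·,...,·], α̃ = (α_1,...,α_{n-1})) be an n-ary Hom-Nambu algebra such that (N, L, α_{n-1}) is its adjoint representation. Define L̃: N^{n-1} → End(N*) by (L̃(x)·f)(y) = −f(L(x)·y) for x ∈ N^{n-1}, f ∈ N*, y ∈ N, and α*_{n-1}: N* → N*, f ↦ f∘α_{n-1}. Then (N*, L̃, α*_{n-1}) is a representation of N if and only if for all x = (x_1,...,x_{n-1}), y ∈ N^{n-1}: L(x)∘L(α̃(y)) − L(y)∘L(α̃(x)) = Σ_{i=1}^{n-1} α_{n-1} ∘ L(α_1(x_1),...,α_{i-1}(x_{i-1}),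 L(y)·x_i, α_i(x_{i+1}),...,α_{n-2}(x_{n-1})). -/
/-- A linear map between vector spaces is determined by its transpose. -/
theorem LinearMap.dualMap_injective {K V W : Type*} [Field K] [AddCommGroup V] [Module K V]
    [AddCommGroup W] [Module K W] :
    Function.Injective (LinearMap.dualMap : (V →ₗ[K] W) → _) := by
  intro f g h
  ext v
  refine Module.eval_apply_injective K (LinearMap.ext fun φ => ?_)
  exact LinearMap.congr_fun (LinearMap.congr_fun h φ) v

/-- For the adjoint representation `(N, L, α_{n-1})` of an `n`-ary
Hom-Nambu algebra, the coadjoint data `(N*, L̃, α*_{n-1})` with `(L̃(x)·f)(y) = −f(L(x)·y)`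
is a representation iff
`L(x)∘L(α̃(y)) − L(y)∘L(α̃(x)) = ∑ᵢ α_{n-1} ∘ L(α₁(x₁),…,L(y)·xᵢ,…,α_{n-2}(x_{n-1}))`. -/
theorem coadjoint_representation_iff
    {K : Type*} [Field K] [CharZero K] {N : Type*} [AddCommGroup N] [Module K N]
    {m : ℕ} (hm : 1 ≤ m)
    (br : MultilinearMap K (fun _ : Fin (m + 1) => N) N)
    (α : Fin m → (N →ₗ[K] N))
    (hNambu : HomNambu (K := K) (⇑br) α)
    (hadj : IsRepCond (K := K) (⇑br) α (fun x => br.curryRight x)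
      (α ⟨m - 1, by omega⟩)) :
    IsRepCond (K := K) (⇑br) α
        (fun x => -LinearMap.dualMap (br.curryRight x))
        (LinearMap.dualMap (α ⟨m - 1, by omega⟩)) ↔
      ∀ x y : Fin m → N,
        br.curryRight x * br.curryRight (fun i => α i (y i)) -
            br.curryRight y * br.curryRight (fun i => α i (x i)) =
          ∑ i : Fin m,
            (α ⟨m - 1, by omega⟩) * br.curryRight (repTuple (K := K) (⇑br) α x y i) := by
  refine forall₂_congr fun x y => ?_
  refine (Eq.congr ?_ ?_).trans (neg_inj.trans LinearMap.dualMap_injective.eq_iff)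
  · ext f v
    simp [LinearMap.dualMap_apply]
  · ext f v
    simp [LinearMap.dualMap_apply, LinearMap.sum_apply]
end

section
/- Let (N, [·,...,·], B) be a quadratic n-ary Nambu algebra and ρ ∈ Aut_S(N,B), i.e. an algebra automorphism with B(ρ(x),y) = B(x,ρ(y)) for all x,y. Then: (1) (N, ρ∘[·,...,·], (ρ,...,ρ), B, ρ) is a Hom-quadratic Hom-Nambu algebra, i.e. B(ρ([x_1,...,x_{n-1},y]), ρ(z)) + B(ρ(y), ρ([x_1,...,x_{n-1},z])) = 0; and (2) (N, ρ∘[·,...,·], (ρ,...,ρ), B_ρ), where B_ρ(x,y) = B(ρ(x),y), is a quadratic Hom-Nambu algebra: B_ρ is nondegenerate, symmetric, invariant for the bracket ρ∘[·,...,·], and B_ρ(ρ(y),z) = B_ρ(y,ρ(z)). -/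
/-- Twisting a Nambu bracket by an algebra endomorphism gives a Hom-Nambu bracket. -/
theorem HomNambu.twist {K : Type*} [Field K] {N : Type*} [AddCommGroup N] [Module K N] {m : ℕ}
    {br : (Fin (m + 1) → N) → N} (h : HomNambu (K := K) br (fun _ => LinearMap.id))
    (ρ : N →ₗ[K] N) (hρ : ∀ x : Fin (m + 1) → N, ρ (br x) = br (fun i => ρ (x i))) :
    HomNambu (K := K) (fun x => ρ (br x)) (fun _ => ρ) := by
  intro x y
  have key := congrArg (fun v => ρ (ρ v)) (h x y)
  simp only [map_sum, LinearMap.id_apply] at key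
  convert key using 2
  · rw [hρ]
    congr 1
    exact (Fin.comp_snoc ρ x (br y)).symm
  · rename_i i _
    rw [hρ (fun j => _)]
    congr 2
    funext j
    split_ifs <;> rfl

/-- Let `(N, br, B)` be a quadratic `n`-ary Nambu algebra and `ρ` a
symmetric automorphism (`ρ ∈ Aut_S(N,B)`).  Then `(N, ρ∘br, (ρ,…,ρ), B, ρ)` is a
Hom-quadratic Hom-Nambu algebra and `(N, ρ∘br, (ρ,…,ρ), B_ρ)`, `B_ρ(x,y) = B(ρ(x),y)`,
is a quadratic Hom-Nambu algebra. -/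
theorem twist_quadratic_nambu
    {K : Type*} [Field K] [CharZero K] {N : Type*} [AddCommGroup N] [Module K N]
    {m : ℕ} (hm : 1 ≤ m)
    (br : MultilinearMap K (fun _ : Fin (m + 1) => N) N)
    (hNambu : HomNambu (K := K) (⇑br) (fun _ => LinearMap.id))
    (B : N →ₗ[K] N →ₗ[K] K)
    (hBsymm : ∀ x y : N, B x y = B y x)
    (hBnondeg : ∀ x : N, (∀ y : N, B x y = 0) → x = 0)
    (hBinv : ∀ (x : Fin m → N) (y z : N),
      B (br (Fin.snoc x y)) z + B y (br (Fin.snoc x z)) = 0)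
    (ρ : N →ₗ[K] N) (hρbij : Function.Bijective ρ)
    (hρalg : ∀ x : Fin (m + 1) → N, ρ (br x) = br (fun i => ρ (x i)))
    (hρB : ∀ x y : N, B (ρ x) y = B x (ρ y)) :
    -- (1) `(N, ρ∘br, (ρ,…,ρ), B, ρ)` is a Hom-quadratic Hom-Nambu algebra:
    (HomNambu (K := K) (fun x => ρ (br x)) (fun _ => ρ) ∧
      ∀ (x : Fin m → N) (y z : N),
        B (ρ (br (Fin.snoc x y))) (ρ z) + B (ρ y) (ρ (br (Fin.snoc x z))) = 0) ∧
    -- (2) `(N, ρ∘br, (ρ,…,ρ), B_ρ)` with `B_ρ(x,y) = B(ρ(x),y)` is quadratic: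
    ((∀ x y : N, B (ρ x) y = B (ρ y) x) ∧
      (∀ x : N, (∀ y : N, B (ρ x) y = 0) → x = 0) ∧
      (∀ (x : Fin m → N) (y z : N),
        B (ρ (ρ (br (Fin.snoc x y)))) z + B (ρ y) (ρ (br (Fin.snoc x z))) = 0) ∧
      (∀ y z : N, B (ρ (ρ y)) z = B (ρ y) (ρ z))) := by
  have hinv : ∀ (x : Fin m → N) (y z : N),
      B (ρ (br (Fin.snoc x y))) (ρ z) + B (ρ y) (ρ (br (Fin.snoc x z))) = 0 := by
    intro x y z
    have hsnoc : ∀ w : N, ρ (br (Fin.snoc x w)) = br (Fin.snoc (fun i => ρ (x i)) (ρ w)) := by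
      intro w
      rw [hρalg]
      exact congrArg br (Fin.comp_snoc ρ x w)
    rw [hsnoc, hsnoc]
    exact hBinv _ _ _
  refine ⟨⟨hNambu.twist ρ hρalg, hinv⟩, ?_, ?_, ?_, fun y z => hρB (ρ y) z⟩
  · intro x y
    rw [hρB, hBsymm]
  · intro x hx
    exact (map_eq_zero_iff ρ hρbij.injective).mp (hBnondeg _ hx)
  · intro x y z
    rw [hρB]
    exact hinv x y z
end

section
/- Let (N, [·,...,·]_N, B) be a quadratic n-ary Nambu-Lie algebra with dual space N*. On L = N ⊕ N* define the n-linear product, for u_i = x_i + f_i with x_i ∈ N and f_i ∈ N*: [u_1,...,u_n]_L = [x_1,...,x_n]_N + Σ_{i=1}^n (−1)^{i+n+1} f_i ∘ L(x_1,...,x̂_i,...,x_n), where x̂_i means x_i is omitted and (f∘L(y_1,...,y_{n-1}))(z) = f([y_1,...,y_{n-1},z]_N), and define B_L(x+f, y+g) = B(x,y) + f(y) + g(x). Then (L, [·,...,·]_L, B_L) is a quadratic n-ary Nambu algebra: [·,...,·]_L satisfies the n-ary Nambu identity and B_L is a nondegenerate symmetric bilinear form satisfying B_L([u_1,...,u_{n-1},v]_L,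 w) + B_L(v, [u_1,...,u_{n-1},w]_L) = 0. -/
/-- The `T*`-extension bracket on `L = N ⊕ N*`:
`[x₁+f₁,…,xₙ+fₙ]_L = [x₁,…,xₙ]_N + ∑ᵢ (−1)^{i+n+1} fᵢ ∘ L(x₁,…,x̂ᵢ,…,xₙ)`
(with 1-based signs; in 0-based form the sign of the `i`-th term is `(−1)^{i+m+1}`). -/
def tStarBracket {K : Type*} [Field K] {N : Type*} [AddCommGroup N] [Module K N] {m : ℕ}
    (br : MultilinearMap K (fun _ : Fin (m + 1) => N) N)
    (u : Fin (m + 1) → N × Module.Dual K N) : N × Module.Dual K N :=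
  (br (fun i => (u i).1),
    ∑ i : Fin (m + 1), ((-1 : K) ^ ((i : ℕ) + m + 1)) •
      ((u i).2 ∘ₗ (br.curryRight (i.removeNth (fun j => (u j).1)))))

/-- The bilinear form `B_L(x+f, y+g) = B(x,y) + f(y) + g(x)` on `L = N ⊕ N*`. -/
def tStarForm {K : Type*} [Field K] {N : Type*} [AddCommGroup N] [Module K N]
    (B : N →ₗ[K] N →ₗ[K] K)
    (u v : N × Module.Dual K N) : K :=
  B u.1 v.1 + u.2 v.1 + v.2 u.1

open Function in
/-- With trivial twists, the Hom-Nambu identity is the Nambu identity, the modified entry on the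
right-hand side being expressed by `Function.update`. -/
lemma homNambu_id_iff {K : Type*} [Field K] {N : Type*} [AddCommGroup N] [Module K N] {m : ℕ}
    (br : (Fin (m + 1) → N) → N) :
    HomNambu (K := K) br (fun _ => LinearMap.id) ↔
      ∀ (x : Fin m → N) (y : Fin (m + 1) → N),
        br (Fin.snoc x (br y)) = ∑ i, br (update y i (br (Fin.snoc x (y i)))) := by
  have key (x : Fin m → N) (y : Fin (m + 1) → N) (i : Fin (m + 1)) :
      (fun j : Fin (m + 1) => if (j : ℕ) < (i : ℕ) then y j
        else if (j : ℕ) = (i : ℕ) then br (Fin.snoc x (y i)) else y j) =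
        update y i (br (Fin.snoc x (y i))) := by
    ext j
    rcases eq_or_ne j i with rfl | h
    · simp
    · simp [h, Fin.val_ne_of_ne h]
  simp only [HomNambu, LinearMap.id_apply, dite_eq_ite, key]

/-- Taking first components commutes with `Fin.snoc`. -/
lemma Fin.fst_snoc {α β : Type*} {m : ℕ} (u : Fin m → α × β) (w : α × β) :
    (fun j => ((Fin.snoc u w : Fin (m + 1) → α × β) j).1) = Fin.snoc (fun j => (u j).1) w.1 := by
  ext j
  cases j using Fin.lastCases <;> simp

section Skew

open Function

variable {K : Type*} [Field K] {N : Type*} [AddCommGroup N] [Module K N] {m : ℕ}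
  {br : MultilinearMap K (fun _ : Fin (m + 1) => N) N}

/-- Replacing the `i`-th argument of a skew-symmetric map by `z` agrees up to sign with omitting
it and appending `z`. -/
lemma map_update_eq_neg_one_pow_smul_map_snoc_removeNth
    (hskew : ∀ (σ : Equiv.Perm (Fin (m + 1))) (x : Fin (m + 1) → N),
      br (x ∘ σ) = (Equiv.Perm.sign σ : ℤ) • br x)
    (x : Fin (m + 1) → N) (i : Fin (m + 1)) (z : N) :
    br (update x i z) = (-1 : K) ^ ((i : ℕ) + m) • br (Fin.snoc (i.removeNth x) z) := by
  have hins (p : Fin (m + 1)) (v : Fin m → N) :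
      br (p.insertNth z v) = (-1 : K) ^ (p : ℕ) • br (Fin.cons z v) := by
    rw [← Fin.cons_comp_cycleRange, hskew, Fin.sign_cycleRange, ← Int.cast_smul_eq_zsmul K]
    simp
  rw [← Fin.insertNth_removeNth, hins, ← Fin.insertNth_last', hins, smul_smul, ← pow_add,
    Fin.val_last, add_assoc, pow_add _ (i : ℕ), Even.neg_one_pow ⟨m, rfl⟩, mul_one]

/-- Exchanging the `j`-th and the last argument of a skew-symmetric map changes the sign. -/
lemma map_update_castSucc_snoc_swap
    (hskew : ∀ (σ : Equiv.Perm (Fin (m + 1))) (x : Fin (m + 1) → N),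
      br (x ∘ σ) = (Equiv.Perm.sign σ : ℤ) • br x)
    (x : Fin m → N) (j : Fin m) (y z : N) :
    br (update (Fin.snoc x y) j.castSucc z) = -br (update (Fin.snoc x z) j.castSucc y) := by
  have hne : j.castSucc ≠ Fin.last m := Fin.castSucc_ne_last j
  have h := hskew (Equiv.swap j.castSucc (Fin.last m)) (update (Fin.snoc x z) j.castSucc y)
  rw [Equiv.Perm.sign_swap hne] at h
  simp only [Units.val_neg, Units.val_one, neg_smul, one_smul] at h
  rw [← h]
  congr 1
  ext k
  cases k using Fin.lastCases with
  | last => simp [hne.symm]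
  | cast k =>
    rcases eq_or_ne k j with rfl | hk
    · simp [hne.symm]
    · have hk' : k.castSucc ≠ j.castSucc := by simpa using hk
      simp [hk', Equiv.swap_apply_of_ne_of_ne hk' (Fin.castSucc_ne_last k)]

lemma tStarBracket_fst (u : Fin (m + 1) → N × Module.Dual K N) :
    (tStarBracket br u).1 = br (fun j => (u j).1) := rfl

/-- The dual component of the `T*`-extension bracket in coadjoint form. -/
lemma tStarBracket_snd_apply
    (hskew : ∀ (σ : Equiv.Perm (Fin (m + 1))) (x : Fin (m + 1) → N),
      br (x ∘ σ) = (Equiv.Perm.sign σ : ℤ) • br x)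
    (u : Fin (m + 1) → N × Module.Dual K N) (z : N) :
    (tStarBracket br u).2 z = -∑ i, (u i).2 (br (update (fun j => (u j).1) i z)) := by
  simp only [tStarBracket, LinearMap.sum_apply, LinearMap.smul_apply, LinearMap.comp_apply,
    MultilinearMap.curryRight_apply, map_update_eq_neg_one_pow_smul_map_snoc_removeNth hskew,
    map_smul, ← Finset.sum_neg_distrib, pow_succ, mul_neg, mul_one, neg_smul]

/-- An invariant form is invariant with respect to every argument of a skew-symmetric bracket. -/
lemma form_map_update_left
    (hskew : ∀ (σ : Equiv.Perm (Fin (m + 1))) (x : Fin (m + 1) → N),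
      br (x ∘ σ) = (Equiv.Perm.sign σ : ℤ) • br x)
    {B : N →ₗ[K] N →ₗ[K] K}
    (hBinv : ∀ (x : Fin m → N) (y z : N),
      B (br (Fin.snoc x y)) z + B y (br (Fin.snoc x z)) = 0)
    (x : Fin (m + 1) → N) (i : Fin (m + 1)) (a z : N) :
    B (br (update x i a)) z = -B a (br (update x i z)) := by
  simp only [map_update_eq_neg_one_pow_smul_map_snoc_removeNth hskew, map_smul,
    LinearMap.smul_apply, eq_neg_of_add_eq_zero_left (hBinv _ a z), smul_neg]

/-- In a quadratic Nambu-Lie algebra the left multiplications by a bracket expand with the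
opposite order of composition to the one prescribed by the Nambu identity. -/
lemma map_update_snoc_bracket
    (hNambu : ∀ (x : Fin m → N) (y : Fin (m + 1) → N),
      br (Fin.snoc x (br y)) = ∑ i, br (update y i (br (Fin.snoc x (y i)))))
    (hskew : ∀ (σ : Equiv.Perm (Fin (m + 1))) (x : Fin (m + 1) → N),
      br (x ∘ σ) = (Equiv.Perm.sign σ : ℤ) • br x)
    {B : N →ₗ[K] N →ₗ[K] K}
    (hBsymm : ∀ x y : N, B x y = B y x)
    (hBnondeg : ∀ x : N, (∀ y : N, B x y = 0) → x = 0)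
    (hBinv : ∀ (x : Fin m → N) (y z : N),
      B (br (Fin.snoc x y)) z + B y (br (Fin.snoc x z)) = 0)
    (x : Fin m → N) (y : Fin (m + 1) → N) (j : Fin m) (z : N) :
    br (update (Fin.snoc x (br y)) j.castSucc z) =
      -∑ i, br (update (Fin.snoc x (y i)) j.castSucc (br (update y i z))) := by
  rw [← sub_eq_zero]
  refine hBnondeg _ fun a => ?_
  have h := congrArg (fun t => B t z) (hNambu (update x j a) y)
  simp only [Fin.snoc_update, map_sum, LinearMap.sum_apply,
    form_map_update_left hskew hBinv, neg_neg] at h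
  rw [hBsymm, map_sub, map_neg, map_sum, ← h, sub_neg_eq_add, add_neg_cancel]

/-- The `T*`-extension bracket of a quadratic Nambu-Lie algebra satisfies the Nambu identity. -/
lemma tStarBracket_nambu
    (hNambu : ∀ (x : Fin m → N) (y : Fin (m + 1) → N),
      br (Fin.snoc x (br y)) = ∑ i, br (update y i (br (Fin.snoc x (y i)))))
    (hskew : ∀ (σ : Equiv.Perm (Fin (m + 1))) (x : Fin (m + 1) → N),
      br (x ∘ σ) = (Equiv.Perm.sign σ : ℤ) • br x)
    {B : N →ₗ[K] N →ₗ[K] K}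
    (hBsymm : ∀ x y : N, B x y = B y x)
    (hBnondeg : ∀ x : N, (∀ y : N, B x y = 0) → x = 0)
    (hBinv : ∀ (x : Fin m → N) (y z : N),
      B (br (Fin.snoc x y)) z + B y (br (Fin.snoc x z)) = 0)
    (u : Fin m → N × Module.Dual K N) (v : Fin (m + 1) → N × Module.Dual K N) :
    tStarBracket br (Fin.snoc u (tStarBracket br v)) =
      ∑ i, tStarBracket br (update v i (tStarBracket br (Fin.snoc u (v i)))) := by
  have fst_snoc := Fin.fst_snoc u
  have fst_update (i : Fin (m + 1)) (w : N × Module.Dual K N) :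
      (fun j => (update v i w j).1) = update (fun j => (v j).1) i w.1 := by
    ext j
    rcases eq_or_ne j i with rfl | h <;> simp [*]
  refine Prod.ext ?_ (LinearMap.ext fun z => ?_)
  · simp only [Prod.fst_sum, tStarBracket_fst, fst_snoc, fst_update, hNambu]
  · set x : Fin m → N := fun j => (u j).1
    set y : Fin (m + 1) → N := fun j => (v j).1
    have nambu_update (k : Fin (m + 1)) :
        br (Fin.snoc x (br (update y k z))) = br (update y k (br (Fin.snoc x z))) +
          ∑ i ∈ Finset.univ.erase k, br (update (update y i (br (Fin.snoc x (y i)))) k z) := by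
      rw [hNambu, ← Finset.add_sum_erase _ _ (Finset.mem_univ k)]
      congr 1
      · simp
      · refine Finset.sum_congr rfl fun i hi => ?_
        have hik : i ≠ k := Finset.ne_of_mem_erase hi
        rw [update_of_ne hik, update_comm hik]
    have inner (i : Fin (m + 1)) :
        (tStarBracket br (update v i (tStarBracket br (Fin.snoc u (v i))))).2 z =
          ∑ j, (u j).2 (br (update (Fin.snoc x (y i)) j.castSucc (br (update y i z)))) +
            (v i).2 (br (Fin.snoc x (br (update y i z)))) -
            ∑ k ∈ Finset.univ.erase i,
              (v k).2 (br (update (update y i (br (Fin.snoc x (y i)))) k z)) := by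
      rw [tStarBracket_snd_apply hskew, ← Finset.add_sum_erase _ _ (Finset.mem_univ i),
        Finset.sum_congr rfl fun k (hk : k ∈ Finset.univ.erase i) => by
          rw [update_of_ne (Finset.ne_of_mem_erase hk)]]
      simp only [fst_update, tStarBracket_fst, fst_snoc, update_self, update_idem]
      rw [tStarBracket_snd_apply hskew, Fin.sum_univ_castSucc]
      simp only [fst_snoc, Fin.snoc_castSucc, Fin.snoc_last, Fin.update_snoc_last]
      ring
    rw [tStarBracket_snd_apply hskew, Fin.sum_univ_castSucc]
    simp only [fst_snoc, Fin.snoc_castSucc, Fin.snoc_last, Fin.update_snoc_last, tStarBracket_fst]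
    rw [tStarBracket_snd_apply hskew, Prod.snd_sum, LinearMap.sum_apply]
    simp only [inner, nambu_update, map_add, map_sum, map_neg, Finset.sum_add_distrib,
      Finset.sum_sub_distrib,
      map_update_snoc_bracket hNambu hskew hBsymm hBnondeg hBinv]
    have comm_erase (F : Fin (m + 1) → Fin (m + 1) → K) :
        ∑ i, ∑ k ∈ Finset.univ.erase i, F i k = ∑ k, ∑ i ∈ Finset.univ.erase k, F i k :=
      Finset.sum_comm' (by simp [ne_comm])
    rw [comm_erase, Finset.sum_comm (s := (Finset.univ : Finset (Fin (m + 1))))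
      (t := (Finset.univ : Finset (Fin m))), Finset.sum_neg_distrib]
    ring

/-- The form `B_L` is invariant under the `T*`-extension bracket. -/
lemma tStarForm_invariant
    (hskew : ∀ (σ : Equiv.Perm (Fin (m + 1))) (x : Fin (m + 1) → N),
      br (x ∘ σ) = (Equiv.Perm.sign σ : ℤ) • br x)
    {B : N →ₗ[K] N →ₗ[K] K}
    (hBinv : ∀ (x : Fin m → N) (y z : N),
      B (br (Fin.snoc x y)) z + B y (br (Fin.snoc x z)) = 0)
    (u : Fin m → N × Module.Dual K N) (v w : N × Module.Dual K N) :
    tStarForm B (tStarBracket br (Fin.snoc u v)) w +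
      tStarForm B v (tStarBracket br (Fin.snoc u w)) = 0 := by
  simp only [tStarForm, tStarBracket_snd_apply hskew, Fin.sum_univ_castSucc, tStarBracket_fst,
    Fin.fst_snoc,
    Fin.snoc_castSucc, Fin.snoc_last, Fin.update_snoc_last]
  simp only [map_update_castSucc_snoc_swap hskew _ _ v.1 w.1, map_neg, Finset.sum_neg_distrib]
  linear_combination hBinv (fun j => (u j).1) v.1 w.1

end Skew

/-- The `T*`-extension `(L = N ⊕ N*, [·,…,·]_L, B_L)` of a quadratic
`n`-ary Nambu-Lie algebra `(N, br, B)` is a quadratic `n`-ary Nambu algebra. -/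
theorem tStar_extension_quadratic_nambu
    {K : Type*} [Field K] [CharZero K] {N : Type*} [AddCommGroup N] [Module K N]
    {m : ℕ} (hm : 1 ≤ m)
    (br : MultilinearMap K (fun _ : Fin (m + 1) => N) N)
    (hNambu : HomNambu (K := K) (⇑br) (fun _ => LinearMap.id))
    (hskew : ∀ (σ : Equiv.Perm (Fin (m + 1))) (x : Fin (m + 1) → N),
      br (x ∘ σ) = (Equiv.Perm.sign σ : ℤ) • br x)
    (B : N →ₗ[K] N →ₗ[K] K)
    (hBsymm : ∀ x y : N, B x y = B y x)
    (hBnondeg : ∀ x : N, (∀ y : N, B x y = 0) → x = 0)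
    (hBinv : ∀ (x : Fin m → N) (y z : N),
      B (br (Fin.snoc x y)) z + B y (br (Fin.snoc x z)) = 0) :
    -- the `T*`-extension bracket satisfies the `n`-ary Nambu identity
    HomNambu (K := K) (tStarBracket br) (fun _ => LinearMap.id) ∧
    -- `B_L` is symmetric
    (∀ u v : N × Module.Dual K N, tStarForm B u v = tStarForm B v u) ∧
    -- `B_L` is nondegenerate
    (∀ u : N × Module.Dual K N, (∀ v, tStarForm B u v = 0) → u = 0) ∧
    -- `B_L` is invariant
    (∀ (u : Fin m → N × Module.Dual K N) (v w : N × Module.Dual K N),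
      tStarForm B (tStarBracket br (Fin.snoc u v)) w +
        tStarForm B v (tStarBracket br (Fin.snoc u w)) = 0) := by
  rw [homNambu_id_iff] at hNambu ⊢
  refine ⟨tStarBracket_nambu hNambu hskew hBsymm hBnondeg hBinv, fun u v => ?_, fun u hu => ?_,
    tStarForm_invariant hskew hBinv⟩
  · simp only [tStarForm, hBsymm u.1]
    ring
  · have hfst : u.1 = 0 :=
      (Module.forall_dual_apply_eq_zero_iff K _).1 fun g => by simpa [tStarForm] using hu (0, g)
    refine Prod.ext hfst (LinearMap.ext fun y => ?_)
    simpa [tStarForm, hfst] using hu (y, 0)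
end

section
/- Let (V, [·,·], α, B, β) be a Hom-quadratic Hom-Lie algebra and γ: V → V a linear map. Let τ: V → K be a trace function (τ([x,y]) = 0 for all x,y) satisfying τ(α(x))τ(y) = τ(x)τ(α(y)), τ(γ(x))τ(y) = τ(x)τ(γ(y)), and τ(α(x))γ(y) = τ(γ(x))α(y) for all x,y ∈ V. Assume moreover B(α(x),y) = B(x,α(y)), B(γ(x),y) = B(x,γ(y)), and τ(x)B(β(y),z) − τ(y)B(β(x),z) = 0 for all x,y,z ∈ V. Then (V, [·,·,·]_τ, (α,γ), B, β), with [x,y,z]_τ = τ(x)[y,z] + τ(y)[z,x] + τ(z)[x,y], is a Hom-quadratic ternary Hom-Nambu-Lie algebra; in particular B([x_1,x_2,y]_τ, β(z)) + B(β(y), [x_1,x_2,z]_τ) = 0. -/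
/-- Let `(V, [·,·], α, B, β)` be a Hom-quadratic Hom-Lie algebra,
`γ : V → V` linear, and `τ` a trace function compatible with `α`, `γ` and `(B, β)` as below.
Then the induced ternary bracket `[x,y,z]_τ = τ(x)[y,z] + τ(y)[z,x] + τ(z)[x,y]` makes
`(V, [·,·,·]_τ, (α,γ), B, β)` a Hom-quadratic ternary Hom-Nambu-Lie algebra. -/
theorem trace_induced_hom_quadratic_ternary
    {K : Type*} [Field K] [CharZero K] {V : Type*} [AddCommGroup V] [Module K V]
    (lb : V →ₗ[K] V →ₗ[K] V)
    (hanti : ∀ x y : V, lb x y = -lb y x)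
    (α : V →ₗ[K] V)
    (hJac : ∀ x y z : V,
      lb (α x) (lb y z) + lb (α y) (lb z x) + lb (α z) (lb x y) = 0)
    (B : V →ₗ[K] V →ₗ[K] K) (β : V →ₗ[K] V)
    (hBsymm : ∀ x y : V, B x y = B y x)
    (hBnondeg : ∀ x : V, (∀ y : V, B x y = 0) → x = 0)
    (hBinv : ∀ x y z : V, B (lb x y) (β z) + B (β y) (lb x z) = 0)
    (γ : V →ₗ[K] V)
    (τ : V →ₗ[K] K)
    (htrace : ∀ x y : V, τ (lb x y) = 0)
    (hτα : ∀ x y : V, τ (α x) * τ y = τ x * τ (α y))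
    (hτγ : ∀ x y : V, τ (γ x) * τ y = τ x * τ (γ y))
    (hταγ : ∀ x y : V, τ (α x) • γ y = τ (γ x) • α y)
    (hBα : ∀ x y : V, B (α x) y = B x (α y))
    (hBγ : ∀ x y : V, B (γ x) y = B x (γ y))
    (hτβ : ∀ x y z : V, τ x * B (β y) z - τ y * B (β x) z = 0) :
    -- the ternary bracket
    ∀ t : V → V → V → V,
      (t = fun x y z => τ x • lb y z + τ y • lb z x + τ z • lb x y) →
      -- skew-symmetry
      ((∀ x y z : V, t x y z = -t y x z) ∧ (∀ x y z : V, t x y z = -t x z y) ∧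
      -- ternary Hom-Nambu identity with twist maps `(α, γ)`
      (∀ x₁ x₂ y₁ y₂ y₃ : V,
        t (α x₁) (γ x₂) (t y₁ y₂ y₃) =
          t (t x₁ x₂ y₁) (α y₂) (γ y₃) + t (α y₁) (t x₁ x₂ y₂) (γ y₃) +
            t (α y₁) (γ y₂) (t x₁ x₂ y₃)) ∧
      -- `β`-invariance of `B`
      (∀ x₁ x₂ y z : V,
        B (t x₁ x₂ y) (β z) + B (β y) (t x₁ x₂ z) = 0)) := by
  intro t ht
  have hskew_left : ∀ x y z : V, t x y z = -t y x z := by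
    intro x y z
    simp only [ht]
    rw [hanti y z, hanti z x, hanti x y]
    module
  have hskew_right : ∀ x y z : V, t x y z = -t x z y := by
    intro x y z
    simp only [ht]
    rw [hanti y z, hanti z x, hanti x y]
    module
  have ht_trace : ∀ x y z : V, τ (t x y z) = 0 := by
    intro x y z
    simp [ht, htrace]
  -- on trace-zero vectors, `γ` enters the twisted bracket only through `τ ∘ γ`
  have ht_twist : ∀ x y w : V, τ w = 0 →
      t (α x) (γ y) w = τ (γ x) • lb (α y) w - τ (γ y) • lb (α x) w := by
    intro x y w hw
    have h : τ (α x) • lb (γ y) w = τ (γ x) • lb (α y) w := by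
      simpa using congrArg (fun v => lb v w) (hταγ x y)
    simp only [ht, hw, h]
    rw [hanti w (α x)]
    module
  refine ⟨hskew_left, hskew_right, ?_, ?_⟩
  · intro x₁ x₂ y₁ y₂ y₃
    rw [hskew_left (t x₁ x₂ y₁), hskew_right _ (t x₁ x₂ y₁),
      hskew_right _ (t x₁ x₂ y₂)]
    simp only [ht_twist _ _ _ (ht_trace _ _ _)]
    simp only [ht, map_add, map_smul]
    have hexch : ∀ x y v : V, (τ (γ x) * τ y) • v = (τ x * τ (γ y)) • v := by
      intro x y v
      rw [hτγ]
    have hJac_right : ∀ x y z : V,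
        lb (α x) (lb y z) = lb (α y) (lb x z) - lb (α z) (lb x y) := by
      intro x y z
      have h := hJac x y z
      rw [hanti z x, map_neg] at h
      linear_combination (norm := module) h
    rw [hanti y₁ x₁, hanti y₂ x₁, hanti y₃ x₁, hanti y₃ y₁]
    simp only [map_neg]
    linear_combination (norm := module)
      hexch x₁ y₁ (lb (α x₂) (lb y₂ y₃)) - hexch x₁ y₂ (lb (α x₂) (lb y₁ y₃))
      + hexch x₁ y₃ (lb (α x₂) (lb y₁ y₂))
      - hexch x₂ y₁ (lb (α x₁) (lb y₂ y₃)) + hexch x₂ y₂ (lb (α x₁) (lb y₁ y₃))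
      - hexch x₂ y₃ (lb (α x₁) (lb y₁ y₂))
      + (τ x₁ * τ (γ y₁)) • hJac_right x₂ y₂ y₃ - (τ x₁ * τ (γ y₂)) • hJac_right x₂ y₁ y₃
      + (τ x₁ * τ (γ y₃)) • hJac_right x₂ y₁ y₂
      - (τ x₂ * τ (γ y₁)) • hJac_right x₁ y₂ y₃ + (τ x₂ * τ (γ y₂)) • hJac_right x₁ y₁ y₃
      - (τ x₂ * τ (γ y₃)) • hJac_right x₁ y₁ y₂
      + hexch y₁ y₂ (lb (α y₃) (lb x₁ x₂)) - hexch y₁ y₃ (lb (α y₂) (lb x₁ x₂))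
      + hexch y₂ y₃ (lb (α y₁) (lb x₁ x₂))
  · intro x₁ x₂ y z
    have hinv : ∀ a x y z : V,
        τ a * B (β z) (lb x y) = -(τ a * B (β y) (lb x z)) := by
      intro a x y z
      linear_combination τ a * hBinv x y z + τ a * hBsymm (β z) (lb x y)
    have hswap : ∀ x y z : V, τ x * B (β y) z = τ y * B (β x) z :=
      fun x y z => sub_eq_zero.mp (hτβ x y z)
    have hzero : τ y * B (β z) (lb x₁ x₂) = 0 := by
      have h : τ y * B (β z) (lb x₁ x₂) = -(τ y * B (β z) (lb x₁ x₂)) := by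
        linear_combination hinv y x₁ x₂ z - hswap y x₂ (lb x₁ z) - hinv x₂ x₁ z y
          + hswap x₂ z (lb x₁ y) + hinv z x₁ y x₂ - hswap z y (lb x₁ x₂)
      exact self_eq_neg.mp h
    simp only [ht, map_add, map_smul, LinearMap.add_apply, LinearMap.smul_apply, smul_eq_mul]
    rw [hanti y x₁, hanti z x₁]
    simp only [map_neg, LinearMap.neg_apply]
    linear_combination τ x₁ * hBinv x₂ y z - τ x₂ * hBinv x₁ y z + 2 * hzero
      + τ y * hBsymm (lb x₁ x₂) (β z) + hswap z y (lb x₁ x₂)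
end

section
/- Let (N, [·,...,·], α, B, β) be a Hom-quadratic multiplicative n-ary Hom-Nambu algebra. Define the (2n−1)-ary product [x_1,...,x_{2n-1}]^{(1)} = [[x_1,...,x_n], α(x_{n+1}),...,α(x_{2n-1})]. Then (N, [·,...,·]^{(1)}, α², B, β') with β' = β∘α is a Hom-quadratic multiplicative (2n−1)-ary Hom-Nambu algebra; in particular B([x_1,...,x_{2n-2},y]^{(1)}, β'(z)) + B(β'(y), [x_1,...,x_{2n-2},z]^{(1)}) = 0 for all x_i, y, z ∈ N. -/
/-- The induced `(2n−1)`-ary product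
`[x₁,…,x_{2n−1}]⁽¹⁾ = [[x₁,…,xₙ], α(x_{n+1}),…,α(x_{2n−1})]` (here `n = m+1`). -/
def higherBracket {K : Type*} [Field K] {N : Type*} [AddCommGroup N] [Module K N] {m : ℕ}
    (br : (Fin (m + 1) → N) → N) (α : N →ₗ[K] N)
    (x : Fin (2 * m + 1) → N) : N :=
  br (Fin.cons
    (br (fun i : Fin (m + 1) => x ⟨(i : ℕ), by have := i.2; omega⟩))
    (fun j : Fin m => α (x ⟨m + 1 + (j : ℕ), by have := j.2; omega⟩)))

section HigherBracket

variable {K : Type*} [Field K] {N : Type*} [AddCommGroup N] [Module K N] {m : ℕ}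

/-- The Hom-Nambu identity with equal twist maps, its summands written with `Function.update`. -/
lemma homNambu_const_iff (br : (Fin (m + 1) → N) → N) (α : N →ₗ[K] N) :
    HomNambu (K := K) br (fun _ => α) ↔ ∀ (x : Fin m → N) (y : Fin (m + 1) → N),
      br (Fin.snoc (fun i => α (x i)) (br y)) =
        ∑ i, br (Function.update (fun j => α (y j)) i (br (Fin.snoc x (y i)))) := by
  refine forall₂_congr fun x y => ?_
  refine Eq.congr_right (Finset.sum_congr rfl fun i _ => congrArg br (funext fun j => ?_))
  rcases lt_trichotomy (j : ℕ) (i : ℕ) with h | h | h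
  · have hne : j ≠ i := fun e => by simp [e] at h
    simp [h, hne]
  · obtain rfl : j = i := Fin.ext h
    simp
  · have hne : j ≠ i := fun e => by simp [e] at h
    simp [h.not_gt, h.ne', hne]

/-- The first `n - 1` arguments of the outer bracket in `[x₁,…,x_{2n-2},y]⁽¹⁾`, where
`n = m + 1`. -/
def higherBracketArgs (hm : 1 ≤ m) (br : (Fin (m + 1) → N) → N) (α : N →ₗ[K] N)
    (x : Fin (2 * m) → N) (i : Fin m) : N :=
  if (i : ℕ) = 0 then br (fun k => x ⟨k, by have := k.2; omega⟩)
  else α (x ⟨m + i, by have := i.2; omega⟩)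

lemma higherBracket_snoc (hm : 1 ≤ m) (br : (Fin (m + 1) → N) → N) (α : N →ₗ[K] N)
    (x : Fin (2 * m) → N) (y : N) :
    higherBracket (K := K) br α (Fin.snoc x y) =
      br (Fin.snoc (higherBracketArgs hm br α x) (α y)) := by
  refine congrArg br (funext fun j => ?_)
  refine Fin.cases ?_ (fun j => ?_) j
  · have h : ∀ i : Fin (m + 1), (i : ℕ) < 2 * m := fun i => by have := i.2; omega
    have h0 : 0 < m := hm
    simp [Fin.snoc, higherBracketArgs, h, h0]
  · by_cases hj : (j : ℕ) + 1 < m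
    · have e : m + 1 + (j : ℕ) = m + (j + 1) := by omega
      simp [Fin.snoc, higherBracketArgs, hj, e, show m + ((j : ℕ) + 1) < 2 * m by omega]
    · have h : ¬ m + 1 + (j : ℕ) < 2 * m := by omega
      simp [Fin.snoc, hj, h]

lemma map_higherBracketArgs (hm : 1 ≤ m) (br : (Fin (m + 1) → N) → N) (α : N →ₗ[K] N)
    (hmult : ∀ x, α (br x) = br (fun i => α (x i))) (x : Fin (2 * m) → N) (i : Fin m) :
    higherBracketArgs hm br α (fun j => α (x j)) i = α (higherBracketArgs hm br α x i) := by
  unfold higherBracketArgs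
  split_ifs <;> simp [hmult]

lemma map_higherBracket (br : (Fin (m + 1) → N) → N) (α : N →ₗ[K] N)
    (hmult : ∀ x, α (br x) = br (fun i => α (x i))) (x : Fin (2 * m + 1) → N) :
    α (higherBracket (K := K) br α x) = higherBracket (K := K) br α (fun i => α (x i)) := by
  unfold higherBracket
  rw [hmult]
  refine congrArg br (funext fun j => ?_)
  refine Fin.cases ?_ (fun j => ?_) j <;> simp [hmult]

lemma higherBracket_update_left (br : (Fin (m + 1) → N) → N) (α : N →ₗ[K] N)
    (f : Fin (2 * m + 1) → N) (i : Fin (m + 1)) (v : N) :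
    higherBracket (K := K) br α (Function.update f ⟨i, by have := i.2; omega⟩ v) =
      br (Fin.cons (br (Function.update (fun k => f ⟨k, by have := k.2; omega⟩) i v))
        (fun j => α (f ⟨m + 1 + j, by have := j.2; omega⟩))) := by
  unfold higherBracket
  congr 3
  · funext k
    simp [Function.update_apply, Fin.ext_iff]
  · funext j
    have : m + 1 + (j : ℕ) ≠ i := by have := i.2; omega
    simp [this]

lemma higherBracket_update_right (br : (Fin (m + 1) → N) → N) (α : N →ₗ[K] N)
    (f : Fin (2 * m + 1) → N) (i : Fin m) (v : N) :
    higherBracket (K := K) br α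
        (Function.update f ⟨m + 1 + i, by have := i.2; omega⟩ v) =
      br (Function.update (Fin.cons (br (fun k => f ⟨k, by have := k.2; omega⟩))
        (fun j => α (f ⟨m + 1 + j, by have := j.2; omega⟩)) : Fin (m + 1) → N) i.succ (α v)) := by
  unfold higherBracket
  rw [← Fin.cons_update]
  congr 3
  · funext k
    have : (k : ℕ) ≠ m + 1 + i := by have := k.2; omega
    simp [this]
  · funext j
    by_cases h : j = i <;> simp [Fin.ext_iff, h, Fin.val_inj]

lemma cons_sum_apply (br : MultilinearMap K (fun _ : Fin (m + 1) => N) N) {ι : Type*}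
    [Fintype ι] (v : ι → N) (t : Fin m → N) :
    br (Fin.cons (∑ i, v i) t) = ∑ i, br (Fin.cons (v i) t) := by
  rw [← MultilinearMap.curryLeft_apply, map_sum, sum_apply]
  rfl

lemma sum_fin_two_mul_add_one (F : Fin (2 * m + 1) → N) :
    ∑ i, F i = ∑ i : Fin (m + 1), F ⟨i, by have := i.2; omega⟩ +
      ∑ i : Fin m, F ⟨m + 1 + i, by have := i.2; omega⟩ := by
  have h : m + 1 + m = 2 * m + 1 := by omega
  rw [← (finCongr h).sum_comp F, Fin.sum_univ_add]
  rfl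

lemma HomNambu.higherBracket (hm : 1 ≤ m) (br : MultilinearMap K (fun _ : Fin (m + 1) => N) N)
    (α : N →ₗ[K] N) (hNambu : HomNambu (K := K) (⇑br) (fun _ => α))
    (hmult : ∀ x : Fin (m + 1) → N, α (br x) = br (fun i => α (x i))) :
    HomNambu (K := K) (m := 2 * m) (_root_.higherBracket (K := K) (⇑br) α)
      (fun _ => α ∘ₗ α) := by
  rw [homNambu_const_iff] at hNambu ⊢
  intro x y
  have hX := map_higherBracketArgs hm br α hmult
  have hXX : higherBracketArgs hm br α (fun i => (α ∘ₗ α) (x i)) =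
      fun i => α (α (higherBracketArgs hm br α x i)) := by
    funext i
    simp only [LinearMap.comp_apply, hX (fun j => α (x j)), hX x]
  rw [higherBracket_snoc hm, hXX, map_higherBracket _ _ hmult]
  conv_lhs => enter [2, 2]; unfold _root_.higherBracket
  rw [hNambu, Fin.sum_univ_succ, sum_fin_two_mul_add_one]
  congr 1
  · simp only [higherBracket_update_left, higherBracket_snoc hm, Fin.cons_zero]
    rw [hNambu]
    set t : Fin m → N := fun j => α (α (α (y ⟨m + 1 + j, by have := j.2; omega⟩)))
    have hcons : ∀ v w : N, (Function.update (fun j => α ((Fin.cons w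
        (fun j : Fin m => α (α (y ⟨m + 1 + j, by have := j.2; omega⟩))) : Fin (m + 1) → N) j)) 0 v)
          = (Fin.cons v t : Fin (m + 1) → N) := by
      intro v w
      funext j
      refine Fin.cases ?_ (fun j => ?_) j <;> simp [t]
    rw [hcons]
    exact cons_sum_apply br _ t
  · refine Finset.sum_congr rfl fun i _ => ?_
    rw [higherBracket_update_right, higherBracket_snoc hm, hmult]
    refine congrArg br ?_
    congr 1
    · funext j
      refine Fin.cases ?_ (fun j => ?_) j <;> simp [hmult]
    · refine congrArg br (funext fun j => ?_)
      refine Fin.lastCases ?_ (fun j => ?_) j <;> simp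

end HigherBracket

/-- From a Hom-quadratic multiplicative `n`-ary Hom-Nambu algebra
`(N, br, α, B, β)` one obtains the Hom-quadratic multiplicative `(2n−1)`-ary Hom-Nambu
algebra `(N, [·,…,·]⁽¹⁾, α², B, β' = β∘α)`. -/
theorem higher_arity_hom_quadratic
    {K : Type*} [Field K] [CharZero K] {N : Type*} [AddCommGroup N] [Module K N]
    {m : ℕ} (hm : 1 ≤ m)
    (br : MultilinearMap K (fun _ : Fin (m + 1) => N) N)
    (α : N →ₗ[K] N)
    (hNambu : HomNambu (K := K) (⇑br) (fun _ => α))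
    (hmult : ∀ x : Fin (m + 1) → N, α (br x) = br (fun i => α (x i)))
    (B : N →ₗ[K] N →ₗ[K] K) (β : N →ₗ[K] N)
    (hBsymm : ∀ x y : N, B x y = B y x)
    (hBnondeg : ∀ x : N, (∀ y : N, B x y = 0) → x = 0)
    (hBα : ∀ x y : N, B (α x) y = B x (α y))
    (hBinv : ∀ (x : Fin m → N) (y z : N),
      B (br (Fin.snoc x y)) (β z) + B (β y) (br (Fin.snoc x z)) = 0) :
    -- `(N, [·,…,·]⁽¹⁾, α²)` is a `(2n−1)`-ary Hom-Nambu algebra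
    HomNambu (K := K) (m := 2 * m) (higherBracket (K := K) (⇑br) α) (fun _ => α ∘ₗ α) ∧
    -- multiplicativity with respect to `α²`
    (∀ x : Fin (2 * m + 1) → N,
      (α ∘ₗ α) (higherBracket (K := K) (⇑br) α x) =
        higherBracket (K := K) (⇑br) α (fun i => (α ∘ₗ α) (x i))) ∧
    -- `α²`-symmetry of `B`
    (∀ x y : N, B ((α ∘ₗ α) x) y = B x ((α ∘ₗ α) y)) ∧
    -- `β' = β∘α`-invariance of `B`
    (∀ (x : Fin (2 * m) → N) (y z : N),
      B (higherBracket (K := K) (⇑br) α (Fin.snoc x y)) ((β ∘ₗ α) z) +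
        B ((β ∘ₗ α) y) (higherBracket (K := K) (⇑br) α (Fin.snoc x z)) = 0) := by
  refine ⟨hNambu.higherBracket hm br α hmult, fun x => ?_, fun x y => ?_, fun x y z => ?_⟩
  · simp only [LinearMap.comp_apply, map_higherBracket _ _ hmult]
  · simp only [LinearMap.comp_apply, hBα]
  · simp only [higherBracket_snoc hm, LinearMap.comp_apply]
    exact hBinv _ _ _
end

section
/- Let n ≥ 3 and (N, [·,...,·], (α_1,...,α_{n-1}), B, β) be a Hom-quadratic n-ary Hom-Nambu algebra. Suppose a ∈ N satisfies α_1(a) = a and [a, x_1,...,x_{n-2}, a] = 0 for all x_i ∈ N. Then (N, [·,...,·]_a, (α_2,...,α_{n-1}), B, β), where [x_1,...,x_{n-1}]_a = [a, x_1,...,x_{n-1}], is a Hom-quadratic (n−1)-ary Hom-Nambu algebra; in particular B([x_1,...,x_{n-2},y]_a, β(z)) + B(β(y), [x_1,...,x_{n-2},z]_a) = 0. -/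
/-- Let `n = m+2 ≥ 3` and let `(N, br, (α₁,…,α_{n−1}), B, β)` be a
Hom-quadratic `n`-ary Hom-Nambu algebra.  If `a ∈ N` satisfies `α₁(a) = a` and
`[a, x₁,…,x_{n−2}, a] = 0` for all `xᵢ`, then `(N, [·,…,·]_a, (α₂,…,α_{n−1}), B, β)` with
`[x₁,…,x_{n−1}]_a = [a, x₁,…,x_{n−1}]` is a Hom-quadratic `(n−1)`-ary Hom-Nambu algebra. -/
theorem lower_arity_hom_quadratic
    {K : Type*} [Field K] [CharZero K] {N : Type*} [AddCommGroup N] [Module K N]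
    {m : ℕ} (hm : 1 ≤ m)
    (br : MultilinearMap K (fun _ : Fin (m + 2) => N) N)
    (α : Fin (m + 1) → (N →ₗ[K] N))
    (hNambu : HomNambu (K := K) (⇑br) α)
    (B : N →ₗ[K] N →ₗ[K] K) (β : N →ₗ[K] N)
    (hBsymm : ∀ x y : N, B x y = B y x)
    (hBnondeg : ∀ x : N, (∀ y : N, B x y = 0) → x = 0)
    (hBα : ∀ (i : Fin (m + 1)) (x y : N), B (α i x) y = B x (α i y))
    (hBinv : ∀ (x : Fin (m + 1) → N) (y z : N),
      B (br (Fin.snoc x y)) (β z) + B (β y) (br (Fin.snoc x z)) = 0)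
    (a : N)
    (ha1 : α 0 a = a)
    (ha2 : ∀ x : Fin m → N, br (Fin.cons a (Fin.snoc x a)) = 0) :
    -- `(N, [·,…,·]_a, (α₂,…,α_{n−1}))` is an `(n−1)`-ary Hom-Nambu algebra
    HomNambu (K := K) (m := m) (fun x => br (Fin.cons a x)) (fun i => α i.succ) ∧
    -- it is Hom-quadratic for the pair `(B, β)`
    (∀ (x : Fin m → N) (y z : N),
      B (br (Fin.cons a (Fin.snoc x y))) (β z) +
        B (β y) (br (Fin.cons a (Fin.snoc x z))) = 0) := by
  have snoc_cons (x : Fin m → N) (y : N) :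
      (Fin.snoc (Fin.cons a x : Fin (m + 1) → N) y : Fin (m + 2) → N) =
        Fin.cons a (Fin.snoc x y : Fin (m + 1) → N) :=
    (Fin.cons_snoc_eq_snoc_cons a x y).symm
  refine ⟨fun x y => ?_, fun x y z => ?_⟩
  · have h := hNambu (Fin.cons a x) (Fin.cons a y)
    have twist : (fun i => α i ((Fin.cons a x : Fin (m + 1) → N) i)) =
        Fin.cons a (fun i => α i.succ (x i)) := by
      funext i
      refine Fin.cases ?_ (fun i => ?_) i <;> simp [ha1]
    rw [twist, snoc_cons, Fin.sum_univ_succ] at h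
    refine h.trans ?_
    -- the summand at the slot of `a` vanishes because its first entry is `[a, x, a] = 0`
    rw [br.map_coord_zero 0 (by simp [snoc_cons, ha2]), zero_add]
    refine Finset.sum_congr rfl fun i _ => congrArg br ?_
    funext j
    refine Fin.cases ?_ (fun j => ?_) j
    · simpa using ha1
    · simp only [Fin.val_succ, Fin.cons_succ, add_lt_add_iff_right, add_left_inj, snoc_cons]
      split_ifs with hlt heq
      · rfl
      · rfl
      · congr 2
        ext
        simp
        omega
  · simpa only [snoc_cons] using hBinv (Fin.cons a x) y z
end

section
/- Let (g, [·,·], B) be a real finite-dimensional quadratic Lie algebra and α ∈ Aut_S(B,g) an involution (a Lie algebra automorphism with α² = id and B(α(x),y) = B(x,α(y))). Let T: g × g → g be the bilinear map characterized by B(T(x,y), z) = B([z,x], y) for all x,y,z ∈ g, and define the ternary bracket [x,y,z] = [T(x,y), z]. Then (g, α∘[·,·,·], (α,α), B_α), where B_α(x,y) = B(α(x),y), is a quadratic multiplicative ternary Hom-Nambu algebra: the bracket α∘[·,·,·] satisfies the ternary Hom-Nambu identity with both twist maps equal to α, α(α[x,y,z]) = α[α(x),α(y),α(z)], B_α is a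 nondegenerate symmetric bilinear form with B_α(α∘[x_1,x_2,y], z) + B_α(y, α∘[x_1,x_2,z]) = 0 and B_α(α(y),z) = B_α(y,α(z)). -/
/-- Two vectors with the same pairings under a nondegenerate bilinear form are equal. -/
theorem eq_of_form_eq {g : Type*} [AddCommGroup g] [Module ℝ g] (B : g →ₗ[ℝ] g →ₗ[ℝ] ℝ)
    (hB : ∀ x : g, (∀ y : g, B x y = 0) → x = 0) {a b : g} (h : ∀ z, B a z = B b z) :
    a = b :=
  sub_eq_zero.mp (hB _ fun z => by rw [map_sub, LinearMap.sub_apply, h, sub_self])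

/-- Let `(g, [·,·], B)` be a real finite-dimensional quadratic Lie algebra,
`α ∈ Aut_S(B,g)` an involution, and `T : g × g → g` the bilinear map determined by
`B(T(x,y),z) = B([z,x],y)`.  With the ternary bracket `[x,y,z] = [T(x,y),z]`, the data
`(g, α∘[·,·,·], (α,α), B_α)` with `B_α(x,y) = B(α(x),y)` is a quadratic multiplicative
ternary Hom-Nambu algebra. -/
theorem faulkner_hom_nambu
    {g : Type*} [LieRing g] [LieAlgebra ℝ g]
    [FiniteDimensional ℝ g]
    (B : g →ₗ[ℝ] g →ₗ[ℝ] ℝ)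
    (hBsymm : ∀ x y : g, B x y = B y x)
    (hBnondeg : ∀ x : g, (∀ y : g, B x y = 0) → x = 0)
    (hBinv : ∀ x y z : g, B ⁅x, y⁆ z = B x ⁅y, z⁆)
    (α : g →ₗ[ℝ] g)
    (hαlie : ∀ x y : g, α ⁅x, y⁆ = ⁅α x, α y⁆)
    (hαinv : α ∘ₗ α = LinearMap.id)
    (hαB : ∀ x y : g, B (α x) y = B x (α y))
    (T : g → g → g)
    (hT : ∀ x y z : g, B (T x y) z = B ⁅z, x⁆ y) :
    ∀ t : g → g → g → g,
      (t = fun x y z => α ⁅T x y, z⁆) →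
      -- ternary Hom-Nambu identity with both twist maps equal to `α`
      ((∀ x₁ x₂ y₁ y₂ y₃ : g,
        t (α x₁) (α x₂) (t y₁ y₂ y₃) =
          t (t x₁ x₂ y₁) (α y₂) (α y₃) + t (α y₁) (t x₁ x₂ y₂) (α y₃) +
            t (α y₁) (α y₂) (t x₁ x₂ y₃)) ∧
      -- multiplicativity of `α`
      (∀ x y z : g, α (t x y z) = t (α x) (α y) (α z)) ∧
      -- `B_α(x,y) = B(α(x),y)` is symmetric and nondegenerate
      (∀ x y : g, B (α x) y = B (α y) x) ∧
      (∀ x : g, (∀ y : g, B (α x) y = 0) → x = 0) ∧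
      -- invariance of `B_α`
      (∀ x₁ x₂ y z : g,
        B (α (t x₁ x₂ y)) z + B (α y) (t x₁ x₂ z) = 0) ∧
      -- `α`-symmetry of `B_α`
      (∀ y z : g, B (α (α y)) z = B (α y) (α z))) := by
  rintro t rfl
  have hαα : ∀ x, α (α x) = x := fun x => LinearMap.congr_fun hαinv x
  have hT_eq : ∀ x y, T x y = ⁅x, y⁆ := fun x y =>
    eq_of_form_eq B hBnondeg fun z => by rw [hT, hBinv, hBsymm]
  simp only [hT_eq, hαlie, hαα]
  refine ⟨fun x₁ x₂ y₁ y₂ y₃ => ?_, fun _ _ _ => trivial, fun x y => ?_, fun x hx => ?_,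
    fun x₁ x₂ y z => ?_, fun y z => ?_⟩
  · rw [leibniz_lie ⁅x₁, x₂⁆ ⁅y₁, y₂⁆ y₃, leibniz_lie ⁅x₁, x₂⁆ y₁ y₂, add_lie]
  · rw [hαB, hBsymm]
  · rw [← hαα x, hBnondeg _ hx, map_zero]
  · rw [← hαlie x₁ x₂, ← hαlie _ z, ← hαB, hαα, ← hBinv, ← lie_skew y, map_neg,
      LinearMap.neg_apply, add_neg_cancel]
  · rw [← hαB, hαα]
end

section
/- Let (N, [·,...,·]) be an n-ary Nambu-Lie algebra, θ ∈ Cent(N), and fix p ∈ {1,...,n}. Define the n-linear product {x_1,...,x_n}_p = [θ(x_1),...,θ(x_p), x_{p+1},...,x_n] (θ applied to the first p arguments). Then (N, {·,...,·}_p, (θ,...,θ)) is an n-ary Hom-Nambu-Lie algebra: {·,...,·}_p is skew-symmetric and satisfies the Hom-Nambu identity with all n−1 twist maps equal to θ. -/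
open Function in
/-- A centroid element of a skew-symmetric bracket can be moved into any slot. -/
theorem centroid_apply_update
    {K : Type*} [Field K] {N : Type*} [AddCommGroup N] [Module K N] {m : ℕ}
    {br : MultilinearMap K (fun _ : Fin (m + 1) => N) N}
    (hskew : ∀ (σ : Equiv.Perm (Fin (m + 1))) (x : Fin (m + 1) → N),
      br (x ∘ σ) = (Equiv.Perm.sign σ : ℤ) • br x)
    {θ : N →ₗ[K] N}
    (hθ : ∀ x : Fin (m + 1) → N, θ (br x) = br (update x 0 (θ (x 0))))
    (i : Fin (m + 1)) (x : Fin (m + 1) → N) :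
    br (update x i (θ (x i))) = θ (br x) := by
  have hcomp : update x i (θ (x i)) ∘ Equiv.swap 0 i =
      update (x ∘ Equiv.swap 0 i) 0 (θ ((x ∘ Equiv.swap 0 i) 0)) := by
    rw [update_comp_equiv]
    simp
  have h := hskew (Equiv.swap 0 i) (update x i (θ (x i)))
  rw [hcomp, ← hθ, hskew, map_zsmul] at h
  rcases Int.units_eq_one_or (Equiv.Perm.sign (Equiv.swap 0 i)) with hs | hs <;>
    simpa [hs] using h.symm

open Function in
theorem centroid_pow_apply_update
    {K : Type*} [Field K] {N : Type*} [AddCommGroup N] [Module K N] {m : ℕ}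
    {br : MultilinearMap K (fun _ : Fin (m + 1) => N) N}
    (hskew : ∀ (σ : Equiv.Perm (Fin (m + 1))) (x : Fin (m + 1) → N),
      br (x ∘ σ) = (Equiv.Perm.sign σ : ℤ) • br x)
    {θ : N →ₗ[K] N}
    (hθ : ∀ x : Fin (m + 1) → N, θ (br x) = br (update x 0 (θ (x 0))))
    (i : Fin (m + 1)) (k : ℕ) (x : Fin (m + 1) → N) :
    br (update x i ((θ ^ k) (x i))) = (θ ^ k) (br x) := by
  induction k with
  | zero => simp
  | succ k ih =>
    have h := centroid_apply_update hskew hθ i (update x i ((θ ^ k) (x i)))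
    rw [update_idem, update_self, ih] at h
    simpa only [pow_succ', Module.End.mul_apply] using h

/-- Powers of a centroid element applied in all slots can be pulled out of the bracket. -/
theorem centroid_pow_apply
    {K : Type*} [Field K] {N : Type*} [AddCommGroup N] [Module K N] {m : ℕ}
    {br : MultilinearMap K (fun _ : Fin (m + 1) => N) N}
    (hskew : ∀ (σ : Equiv.Perm (Fin (m + 1))) (x : Fin (m + 1) → N),
      br (x ∘ σ) = (Equiv.Perm.sign σ : ℤ) • br x)
    {θ : N →ₗ[K] N}
    (hθ : ∀ x : Fin (m + 1) → N, θ (br x) = br (Function.update x 0 (θ (x 0))))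
    (k : Fin (m + 1) → ℕ) (x : Fin (m + 1) → N) :
    br (fun i => (θ ^ k i) (x i)) = (θ ^ ∑ i, k i) (br x) := by
  have key : ∀ s : Finset (Fin (m + 1)),
      br (fun i => if i ∈ s then (θ ^ k i) (x i) else x i) = (θ ^ ∑ i ∈ s, k i) (br x) := by
    intro s
    induction s using Finset.induction_on with
    | empty => simp
    | insert a s ha ih =>
      rw [Finset.sum_insert ha, pow_add, Module.End.mul_apply, ← ih,
        ← centroid_pow_apply_update hskew hθ a]
      congr 1
      funext i
      by_cases hi : i = a
      · subst hi
        simp [ha]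
      · simp [hi]
  simpa using key Finset.univ

/-- Twisting the first `p` slots by a centroid element is composing with its `p`-th power. -/
theorem centroid_twist_eq_pow
    {K : Type*} [Field K] {N : Type*} [AddCommGroup N] [Module K N] {m : ℕ}
    {br : MultilinearMap K (fun _ : Fin (m + 1) => N) N}
    (hskew : ∀ (σ : Equiv.Perm (Fin (m + 1))) (x : Fin (m + 1) → N),
      br (x ∘ σ) = (Equiv.Perm.sign σ : ℤ) • br x)
    {θ : N →ₗ[K] N}
    (hθ : ∀ x : Fin (m + 1) → N, θ (br x) = br (Function.update x 0 (θ (x 0))))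
    {p : ℕ} (hp : p ≤ m + 1) (x : Fin (m + 1) → N) :
    br (fun i => if (i : ℕ) < p then θ (x i) else x i) = (θ ^ p) (br x) := by
  have h := centroid_pow_apply hskew hθ (fun i => if (i : ℕ) < p then 1 else 0) x
  have hsum : ∑ i : Fin (m + 1), (if (i : ℕ) < p then 1 else 0) = p := by
    simp [Fin.card_filter_val_lt, hp]
  rw [hsum] at h
  rw [← h]
  congr 1
  funext i
  split_ifs <;> simp

/-- Let `(N, br)` be an `n`-ary Nambu-Lie algebra, `θ ∈ Cent(N)` and
`p ∈ {1,…,n}`.  The product `{x₁,…,xₙ}_p = [θ(x₁),…,θ(x_p), x_{p+1},…,xₙ]` together with all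
twist maps equal to `θ` is an `n`-ary Hom-Nambu-Lie algebra. -/
theorem centroid_twisted_homNambuLie
    {K : Type*} [Field K] [CharZero K] {N : Type*} [AddCommGroup N] [Module K N]
    {m : ℕ} (hm : 1 ≤ m)
    (br : MultilinearMap K (fun _ : Fin (m + 1) => N) N)
    (hNambu : HomNambu (K := K) (⇑br) (fun _ => LinearMap.id))
    (hskew : ∀ (σ : Equiv.Perm (Fin (m + 1))) (x : Fin (m + 1) → N),
      br (x ∘ σ) = (Equiv.Perm.sign σ : ℤ) • br x)
    (θ : N →ₗ[K] N)
    (hθ : ∀ x : Fin (m + 1) → N,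
      θ (br x) = br (Function.update x 0 (θ (x 0))))
    (p : ℕ) (hp1 : 1 ≤ p) (hp2 : p ≤ m + 1) :
    -- skew-symmetry of `{·,…,·}_p`
    (∀ (σ : Equiv.Perm (Fin (m + 1))) (x : Fin (m + 1) → N),
      br (fun i => if (i : ℕ) < p then θ (x (σ i)) else x (σ i)) =
        (Equiv.Perm.sign σ : ℤ) • br (fun i => if (i : ℕ) < p then θ (x i) else x i)) ∧
    -- Hom-Nambu identity with all twist maps equal to `θ`
    HomNambu (K := K)
      (fun x => br (fun i => if (i : ℕ) < p then θ (x i) else x i))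
      (fun _ => θ) := by
  have htw := centroid_twist_eq_pow hskew hθ hp2
  refine ⟨fun σ x => ?_, fun x y => ?_⟩
  · rw [htw x, ← map_zsmul, ← hskew]
    exact htw (x ∘ σ)
  · simp only [htw]
    rw [← map_sum]
    congr 1
    have hl : br (Fin.snoc (fun i => θ (x i)) ((θ ^ p) (br y))) =
        (θ ^ (m + p)) (br (Fin.snoc x (br y))) := by
      have h := centroid_pow_apply hskew hθ (Fin.snoc (fun _ => 1) p : Fin (m + 1) → ℕ)
        (Fin.snoc x (br y))
      simp only [Fin.sum_univ_castSucc, Fin.snoc_castSucc, Fin.snoc_last, Finset.sum_const,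
        Finset.card_univ, Fintype.card_fin, smul_eq_mul, mul_one] at h
      rw [← h]
      congr 1
      funext i
      induction i using Fin.lastCases <;> simp
    rw [hl]
    have hN := hNambu x y
    simp only [LinearMap.id_apply] at hN
    rw [hN, map_sum]
    refine Finset.sum_congr rfl fun i _ => ?_
    have hsum : ∑ j : Fin (m + 1), (if j = i then p else 1) = m + p := by
      rw [Fin.sum_univ_succAbove _ i]
      simp [add_comm]
    rw [← hsum, ← centroid_pow_apply hskew hθ]
    congr 1
    funext j
    rcases lt_trichotomy j i with h | h | h
    · simp [h, h.ne]
    · simp [h]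
    · simp [h.ne', h.not_gt, Fin.val_inj]
end
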